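/- Let d ≥ 1 and let I : C²_b(ℝ^d) → C_b(ℝ^d) be Lipschitz with constant K₀ (i.e. ‖I(u) − I(v)‖_∞ ≤ K₀‖u − v‖_{C²} for all u, v ∈ C²_b(ℝ^d)), satisfy the global comparison property, and satisfy the locality assumption. Then there exist a constant Λ (depending only on d and K₀) and a family 𝒦 of Lévy-type functionals, each based at some point of ℝ^d and each with |A| ≤ Λ, |B| ≤ Λ, |C| ≤ Λ and ∫ min(1,|y−x|²) dμ(y) ≤ Λ, such that: (i) for all u, v ∈ C²_b(ℝ^d) and all x ∈ ℝ^d there exists L ∈ 𝒦 based at x with I(u)(x) ≤ I(v)(x) + L(u − v); and consequently (ii) for every u ∈ C²_b(ℝ^d) and every x ∈ ℝ^d, I(u)(x) = inf over v ∈ C²_b(ℝ^d) of the sup over L ∈ 𝒦 based at x of ( I(v)(x) + L(u − v) ), the infimum being attained at v = u. -/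

import Mathlib

open MeasureTheory Metric Filter Set

noncomputable section

abbrev Euc (d : ℕ) := EuclideanSpace ℝ (Fin d)

variable {d : ℕ}

/-- sup norm of a function -/
def supNorm (u : Euc d → ℝ) : ℝ := ⨆ x, |u x|

/-- sup norm of the gradient -/
def gradSup (u : Euc d → ℝ) : ℝ := ⨆ x, ‖fderiv ℝ u x‖

/-- sup norm of the Hessian -/
def hessSup (u : Euc d → ℝ) : ℝ := ⨆ x, ‖iteratedFDeriv ℝ 2 u x‖

/-- the `C²` norm : `sup|u| + sup|∇u| + sup|D²u|` -/
def C2Norm (u : Euc d → ℝ) : ℝ := supNorm u + gradSup u + hessSup u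

/-- membership in `C²_b(ℝ^d)` -/
def IsC2b (u : Euc d → ℝ) : Prop :=
  ContDiff ℝ 2 u ∧ ∃ M : ℝ, ∀ x, |u x| ≤ M ∧ ‖fderiv ℝ u x‖ ≤ M ∧ ‖iteratedFDeriv ℝ 2 u x‖ ≤ M

/-- membership in `C_b(ℝ^d)` -/
def IsCb (f : Euc d → ℝ) : Prop := Continuous f ∧ ∃ M : ℝ, ∀ x, |f x| ≤ M

/-- the global comparison property, on a domain `dom` of functions -/
def GCP (dom : (Euc d → ℝ) → Prop) (I : (Euc d → ℝ) → Euc d → ℝ) : Prop :=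
  ∀ u v, dom u → dom v → (∀ y, u y ≤ v y) → ∀ x, u x = v x → I u x ≤ I v x

/-- `I` is Lipschitz with constant `K₀` from `(dom, N)` into sup norm -/
def LipWith (K₀ : ℝ) (dom : (Euc d → ℝ) → Prop) (N : (Euc d → ℝ) → ℝ)
    (I : (Euc d → ℝ) → Euc d → ℝ) : Prop :=
  ∀ u v, dom u → dom v → ∀ x, |I u x - I v x| ≤ K₀ * N (fun y => u y - v y)

/-- sup of `|u|` over the closed ball of radius `r` about the origin -/
def localSup (r : ℝ) (u : Euc d → ℝ) : ℝ := ⨆ x ∈ closedBall (0 : Euc d) r, |u x|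

def localGradSup (r : ℝ) (u : Euc d → ℝ) : ℝ :=
  ⨆ x ∈ closedBall (0 : Euc d) r, ‖fderiv ℝ u x‖

def localHessSup (r : ℝ) (u : Euc d → ℝ) : ℝ :=
  ⨆ x ∈ closedBall (0 : Euc d) r, ‖iteratedFDeriv ℝ 2 u x‖

/-- the `C²` norm restricted to the closed ball of radius `r` -/
def localC2Norm (r : ℝ) (u : Euc d → ℝ) : ℝ := localSup r u + localGradSup r u + localHessSup r u

/-- the locality assumption on `I`, relative to a family of local norms `locN r` -/
def Locality (dom : (Euc d → ℝ) → Prop) (locN : ℝ → (Euc d → ℝ) → ℝ)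
    (I : (Euc d → ℝ) → Euc d → ℝ) : Prop :=
  ∃ C₀ : ℝ, ∃ ω : ℝ → ℝ, (∀ r > (0 : ℝ), 0 < ω r) ∧ Tendsto ω atTop (nhds 0) ∧
    ∃ r₀ : ℝ, ∀ r ≥ r₀, ∀ u v, dom u → dom v → ∀ x : Euc d, ‖x‖ ≤ r →
      |I u x - I v x| ≤ C₀ * locN (2 * r) (fun y => u y - v y)
        + C₀ * ω r * supNorm (fun y => u y - v y)

/-- the data of a Lévy-type functional based at `base` -/
structure LevyData (d : ℕ) where
  base : Euc d
  A : Matrix (Fin d) (Fin d) ℝ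
  B : Euc d
  C : ℝ
  μ : Measure (Euc d)

/-- action of a Lévy-type functional:
`tr(A D²u(x)) + B·∇u(x) + C u(x) + ∫ (u(y) - u(x) - 1_{B₁(x)}(y) ∇u(x)·(y-x)) dμ(y)` -/
def LevyData.apply (L : LevyData d) (u : Euc d → ℝ) : ℝ :=
  (∑ i, ∑ j, L.A i j *
      iteratedFDeriv ℝ 2 u L.base ![EuclideanSpace.single i (1:ℝ), EuclideanSpace.single j (1:ℝ)])
    + fderiv ℝ u L.base L.B + L.C * u L.base
    + ∫ y, (u y - u L.base -
        Set.indicator (ball L.base 1) (fun z => fderiv ℝ u L.base (z - L.base)) y) ∂L.μ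

/-- quantitative bounds on the ingredients of a Lévy-type functional -/
def LevyBounds (Λ : ℝ) (L : LevyData d) : Prop :=
  L.A.IsSymm ∧ L.A.PosSemidef ∧ (∀ i j, |L.A i j| ≤ Λ) ∧ ‖L.B‖ ≤ Λ ∧ |L.C| ≤ Λ ∧
    L.μ {L.base} = 0 ∧
    (∫⁻ y, ENNReal.ofReal (min 1 (‖y - L.base‖ ^ 2)) ∂L.μ) ≤ ENNReal.ofReal Λ

/-- quantitative membership in `C²_b` -/
def Bd (M : ℝ) (u : Euc d → ℝ) : Prop :=
  ContDiff ℝ 2 u ∧ ∀ x, |u x| ≤ M ∧ ‖fderiv ℝ u x‖ ≤ M ∧ ‖iteratedFDeriv ℝ 2 u x‖ ≤ M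

theorem Bd.isC2b {M : ℝ} {u : Euc d → ℝ} (h : Bd M u) : IsC2b u := ⟨h.1, M, h.2⟩

theorem Bd.nonneg {M : ℝ} {u : Euc d → ℝ} (h : Bd M u) : 0 ≤ M :=
  (abs_nonneg _).trans (h.2 0).1

theorem Bd.mono {M N : ℝ} {u : Euc d → ℝ} (h : Bd M u) (hMN : M ≤ N) : Bd N u :=
  ⟨h.1, fun x => ⟨(h.2 x).1.trans hMN, (h.2 x).2.1.trans hMN, (h.2 x).2.2.trans hMN⟩⟩

theorem Bd.c2Norm_le {M : ℝ} {u : Euc d → ℝ} (h : Bd M u) : C2Norm u ≤ 3 * M := by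
  have h1 : supNorm u ≤ M := ciSup_le fun x => (h.2 x).1
  have h2 : gradSup u ≤ M := ciSup_le fun x => (h.2 x).2.1
  have h3 : hessSup u ≤ M := ciSup_le fun x => (h.2 x).2.2
  unfold C2Norm
  linarith

theorem Bd.add {M N : ℝ} {u v : Euc d → ℝ} (h : Bd M u) (k : Bd N v) :
    Bd (M + N) (fun y => u y + v y) := by
  refine ⟨h.1.add k.1, fun x => ⟨(abs_add_le _ _).trans (add_le_add (h.2 x).1 (k.2 x).1), ?_, ?_⟩⟩
  · rw [fderiv_fun_add (h.1.differentiable (by norm_num) x) (k.1.differentiable (by norm_num) x)]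
    exact (norm_add_le _ _).trans (add_le_add (h.2 x).2.1 (k.2 x).2.1)
  · have : iteratedFDeriv ℝ 2 (fun y => u y + v y) x
        = iteratedFDeriv ℝ 2 u x + iteratedFDeriv ℝ 2 v x :=
      iteratedFDeriv_add_apply h.1.contDiffAt k.1.contDiffAt
    rw [this]
    exact (norm_add_le _ _).trans (add_le_add (h.2 x).2.2 (k.2 x).2.2)

theorem Bd.smul {M : ℝ} {u : Euc d → ℝ} (h : Bd M u) (c : ℝ) :
    Bd (|c| * M) (fun y => c * u y) := by
  refine ⟨contDiff_const.mul h.1, fun x => ⟨?_, ?_, ?_⟩⟩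
  · rw [abs_mul]
    exact mul_le_mul_of_nonneg_left (h.2 x).1 (abs_nonneg c)
  · rw [fderiv_const_mul (h.1.differentiable (by norm_num) x), norm_smul, Real.norm_eq_abs]
    exact mul_le_mul_of_nonneg_left (h.2 x).2.1 (abs_nonneg c)
  · have : iteratedFDeriv ℝ 2 (fun y => c * u y) x = c • iteratedFDeriv ℝ 2 u x :=
      iteratedFDeriv_const_smul_apply (a := c) h.1.contDiffAt
    rw [this, norm_smul, Real.norm_eq_abs]
    exact mul_le_mul_of_nonneg_left (h.2 x).2.2 (abs_nonneg c)

theorem Bd.const (c : ℝ) : Bd |c| (fun _ : Euc d => c) := by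
  refine ⟨contDiff_const, fun x => ⟨le_rfl, ?_, ?_⟩⟩
  · simp
  · rw [iteratedFDeriv_const_of_ne (by norm_num)]
    simp

theorem Bd.sum {ι : Type*} (s : Finset ι) {M : ι → ℝ} {u : ι → Euc d → ℝ}
    (h : ∀ i, Bd (M i) (u i)) : Bd (∑ i ∈ s, M i) (fun y => ∑ i ∈ s, u i y) := by
  classical
  induction s using Finset.induction_on with
  | empty => simpa using Bd.const (d := d) 0
  | insert i s hi ih =>
    simp only [Finset.sum_insert hi]
    exact (h i).add ih

theorem Bd.translate {M : ℝ} {u : Euc d → ℝ} (h : Bd M u) (a : Euc d) :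
    Bd M (fun y => u (y - a)) := by
  refine ⟨h.1.comp (contDiff_id.sub contDiff_const), fun x => ⟨(h.2 _).1, ?_, ?_⟩⟩
  · rw [fderiv_comp_sub]
    exact (h.2 _).2.1
  · rw [iteratedFDeriv_comp_sub]
    exact (h.2 _).2.2

theorem exists_Bd_of_compact {u : Euc d → ℝ} (hu : ContDiff ℝ 2 u) (hc : HasCompactSupport u) :
    ∃ M, Bd M u := by
  obtain ⟨a, ha⟩ := hc.exists_bound_of_continuous hu.continuous
  obtain ⟨b, hb⟩ := (hc.fderiv ℝ).exists_bound_of_continuous (hu.continuous_fderiv (by norm_num))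
  obtain ⟨c, hcc⟩ := (hc.iteratedFDeriv (𝕜 := ℝ) 2).exists_bound_of_continuous
    (hu.continuous_iteratedFDeriv (m := 2) le_rfl)
  refine ⟨max a (max b c), hu, fun x => ⟨(ha x).trans (le_max_left _ _), ?_, ?_⟩⟩
  · exact (hb x).trans ((le_max_left _ _).trans (le_max_right _ _))
  · exact (hcc x).trans ((le_max_right _ _).trans (le_max_right _ _))

/-- the barrier functions: a cut-off of the linear functions and a function `ψ ≥ min 1 |z|²`. -/
theorem exists_barriers (d : ℕ) : ∃ M : ℝ, 1 ≤ M ∧ ∃ (χ ψ : Euc d → ℝ),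
    (∀ z, ‖z‖ ≤ 1 → χ z = 1) ∧ (∀ z, 0 ≤ χ z) ∧ (∀ z, χ z ≤ 1) ∧ (∀ z, 2 ≤ ‖z‖ → χ z = 0) ∧
    ψ 0 = 0 ∧ (∀ z, min 1 (‖z‖ ^ 2) ≤ ψ z) ∧ Bd M ψ ∧
    ∀ i : Fin d, Bd M (fun z => z i * χ z) := by
  let f : ContDiffBump (0 : Euc d) := ⟨1, 2, by norm_num, by norm_num⟩
  have h1 : ∀ z, ‖z‖ ≤ 1 → f z = 1 := fun z hz =>
    f.one_of_mem_closedBall (by simpa [f] using hz)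
  have hsm : ContDiff ℝ 2 f := f.contDiff
  have hcs : HasCompactSupport f := f.hasCompactSupport
  obtain ⟨M1, hM1⟩ := exists_Bd_of_compact (u := fun z => (‖z‖ ^ 2 - 1) * f z)
    (((contDiff_norm_sq ℝ).sub contDiff_const).mul hsm) hcs.mul_left
  have hi : ∀ i : Fin d, ∃ M, Bd M (fun z : Euc d => z i * f z) := fun i =>
    exists_Bd_of_compact ((contDiff_euclidean.1 contDiff_id i).mul hsm) hcs.mul_left
  choose Mi hMi using hi
  have hpos : ∀ i, 0 ≤ Mi i := fun i => (hMi i).nonneg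
  have hsum : 0 ≤ ∑ i, Mi i := Finset.sum_nonneg fun i _ => hpos i
  have hM1p := hM1.nonneg
  refine ⟨1 + M1 + ∑ i, Mi i, by linarith, f, fun z => 1 + (‖z‖ ^ 2 - 1) * f z, h1,
    fun z => f.nonneg, fun z => f.le_one, ?_, ?_, ?_, ?_, ?_⟩
  · intro z hz
    exact f.zero_of_le_dist (by simpa [f] using hz)
  · simp [h1 0]
  · intro z
    have a := f.nonneg (x := z)
    have b := f.le_one (x := z)
    rcases le_total 1 (‖z‖ ^ 2) with h | h
    · rw [min_eq_left h]; nlinarith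
    · rw [min_eq_right h]; nlinarith
  · have := (Bd.const (d := d) 1).add hM1
    rw [abs_one] at this
    exact this.mono (by linarith)
  · intro i
    refine (hMi i).mono ?_
    have := Finset.single_le_sum (f := Mi) (fun i _ => hpos i) (Finset.mem_univ i)
    linarith

theorem IsC2b.sub {u v : Euc d → ℝ} (hu : IsC2b u) (hv : IsC2b v) :
    ∃ M, Bd M (fun y => u y - v y) := by
  obtain ⟨hu, M, hM⟩ := hu
  obtain ⟨hv, N, hN⟩ := hv
  have h1 : Bd M u := ⟨hu, hM⟩
  have h2 : Bd N v := ⟨hv, hN⟩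
  refine ⟨_, by simpa [sub_eq_add_neg] using h1.add (h2.smul (-1))⟩

/-- the integrand of a Lévy functional -/
def lint (w : Euc d → ℝ) (x y : Euc d) : ℝ :=
  w y - w x - Set.indicator (ball x 1) (fun z => fderiv ℝ w x (z - x)) y

theorem lint_bound {M : ℝ} {w : Euc d → ℝ} (h : Bd M w) (x y : Euc d) :
    |lint w x y| ≤ 2 * M * min 1 (‖y - x‖ ^ 2) := by
  have hM := h.nonneg
  unfold lint
  by_cases hy : y ∈ ball x 1
  · rw [indicator_of_mem hy]
    have hy1 : ‖y - x‖ < 1 := by simpa [dist_eq_norm] using hy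
    have hy2 : ‖y - x‖ ^ 2 ≤ 1 := by nlinarith [norm_nonneg (y - x)]
    rw [min_eq_right hy2]
    have hd1 : Differentiable ℝ (fderiv ℝ w) :=
      (h.1.fderiv_right (m := 1) (by norm_num)).differentiable (by norm_num)
    have hb : ∀ z, ‖fderiv ℝ (fderiv ℝ w) z‖ ≤ M := fun z => by
      rw [← norm_iteratedFDeriv_one, norm_iteratedFDeriv_fderiv]
      exact (h.2 z).2.2
    have hl : ∀ z, ‖fderiv ℝ w z - fderiv ℝ w x‖ ≤ M * ‖z - x‖ := fun z =>
      convex_univ.norm_image_sub_le_of_norm_fderiv_le (𝕜 := ℝ) (fun z _ => hd1 z) (fun z _ => hb z)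
        (mem_univ x) (mem_univ z)
    have := (convex_closedBall x ‖y - x‖).norm_image_sub_le_of_norm_fderiv_le' (𝕜 := ℝ) (f := w)
      (φ := fderiv ℝ w x) (C := M * ‖y - x‖) (x := x) (y := y)
      (fun z _ => h.1.differentiable (by norm_num) z)
      (fun z hz => (hl z).trans (mul_le_mul_of_nonneg_left
        (by simpa [dist_eq_norm] using hz) hM))
      (by simp) (by simp [dist_eq_norm])
    rw [Real.norm_eq_abs] at this
    nlinarith [sq_nonneg ‖y - x‖]
  · rw [indicator_of_notMem hy]
    have hy1 : 1 ≤ ‖y - x‖ := by simpa [dist_eq_norm] using hy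
    rw [min_eq_left (by nlinarith)]
    have a := abs_le.1 (h.2 x).1
    have b := abs_le.1 (h.2 y).1
    rw [abs_le]
    constructor <;> linarith

theorem apply_bound {M Λ : ℝ} {w : Euc d → ℝ} (h : Bd M w) (L : LevyData d)
    (hL : LevyBounds Λ L) (hA : L.A = 0) (hΛ : 0 ≤ Λ) : L.apply w ≤ 4 * (M * Λ) := by
  obtain ⟨-, -, -, hB, hC, -, hμ⟩ := hL
  have hM := h.nonneg
  have e1 : fderiv ℝ w L.base L.B ≤ M * Λ :=
    (le_abs_self _).trans (((fderiv ℝ w L.base).le_opNorm L.B).trans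
      (mul_le_mul (h.2 _).2.1 hB (norm_nonneg _) hM))
  have e2 : L.C * w L.base ≤ M * Λ := by
    refine (le_abs_self _).trans ?_
    rw [abs_mul, mul_comm]
    exact mul_le_mul (h.2 _).1 hC (abs_nonneg _) hM
  have e3 : ∫ y, lint w L.base y ∂L.μ ≤ 2 * M * Λ := by
    refine (Real.le_norm_self _).trans ((norm_integral_le_lintegral_norm _).trans ?_)
    refine ENNReal.toReal_le_of_le_ofReal (by positivity) ?_
    calc ∫⁻ y, ENNReal.ofReal ‖lint w L.base y‖ ∂L.μ
        ≤ ∫⁻ y, ENNReal.ofReal (2 * M) * ENNReal.ofReal (min 1 (‖y - L.base‖ ^ 2)) ∂L.μ := by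
          refine lintegral_mono fun y => ?_
          rw [← ENNReal.ofReal_mul (by positivity)]
          exact ENNReal.ofReal_le_ofReal (lint_bound h _ _)
      _ = ENNReal.ofReal (2 * M) * ∫⁻ y, ENNReal.ofReal (min 1 (‖y - L.base‖ ^ 2)) ∂L.μ :=
          lintegral_const_mul' _ _ ENNReal.ofReal_ne_top
      _ ≤ ENNReal.ofReal (2 * M) * ENNReal.ofReal Λ := by gcongr
      _ = ENNReal.ofReal (2 * M * Λ) := (ENNReal.ofReal_mul (by positivity)).symm
  unfold lint at e3
  unfold LevyData.apply
  rw [hA]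
  simp only [Matrix.zero_apply, zero_mul, Finset.sum_const_zero, zero_add]
  linarith

/-- existence of a near-extremal Lévy functional -/
theorem exists_extremal {M Λ : ℝ} (hΛ : 0 ≤ Λ) {w : Euc d → ℝ} (h : Bd M w) (x : Euc d) :
    ∃ S : ℝ, 0 ≤ S ∧ (∀ y, lint w x y ≤ S * min 1 (‖y - x‖ ^ 2)) ∧
      ∃ L : LevyData d, LevyBounds Λ L ∧ L.A = 0 ∧ L.base = x ∧
        Λ * (‖fderiv ℝ w x‖ + |w x| + S / 2) ≤ L.apply w := by
  set m : Euc d → ℝ := fun y => min 1 (‖y - x‖ ^ 2) with hm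
  have hm0 : ∀ y, y ≠ x → 0 < m y := fun y hy => by
    have : 0 < ‖y - x‖ := norm_pos_iff.2 (sub_ne_zero.2 hy)
    exact lt_min one_pos (by positivity)
  have hmx : m x = 0 := by simp [hm]
  have hlx : lint w x x = 0 := by simp [lint]
  set q : Euc d → ℝ := fun y => lint w x y / m y with hq
  have hM := h.nonneg
  have hbd : BddAbove (range q) := by
    refine ⟨2 * M, ?_⟩
    rintro _ ⟨y, rfl⟩
    by_cases hy : y = x
    · subst hy; simp [hq, hmx, hM]
    · exact (div_le_iff₀ (hm0 y hy)).2 ((le_abs_self _).trans (lint_bound h x y))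
  have hS0 : 0 ≤ ⨆ y, q y := by
    refine le_trans ?_ (le_ciSup hbd x)
    simp [hq, hmx]
  refine ⟨⨆ y, q y, hS0, ?_, ?_⟩
  · intro y
    by_cases hy : y = x
    · subst hy; simp [hlx]
    · exact (div_le_iff₀ (hm0 y hy)).1 (le_ciSup hbd y)
  -- the drift
  obtain ⟨B, hB1, hB2⟩ : ∃ B : Euc d, ‖B‖ ≤ Λ ∧ fderiv ℝ w x B = Λ * ‖fderiv ℝ w x‖ := by
    set p := fderiv ℝ w x
    by_cases hp : p = 0
    · exact ⟨0, by simpa using hΛ, by simp [hp]⟩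
    set b := (InnerProductSpace.toDual ℝ (Euc d)).symm p with hb
    have hbn : ‖b‖ = ‖p‖ := by simp [hb]
    have hpn : ‖p‖ ≠ 0 := norm_ne_zero_iff.2 hp
    have hpb : p b = ‖p‖ ^ 2 := by
      rw [← hbn, ← real_inner_self_eq_norm_sq]
      conv_rhs => rw [hb]
      rw [InnerProductSpace.toDual_symm_apply]
    refine ⟨(Λ / ‖p‖) • b, ?_, ?_⟩
    · rw [norm_smul, hbn, Real.norm_eq_abs, abs_of_nonneg (by positivity)]
      exact (div_mul_cancel₀ _ hpn).le
    · rw [map_smul, hpb, smul_eq_mul]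
      field_simp
  -- the zero order term
  obtain ⟨C, hC1, hC2⟩ : ∃ C : ℝ, |C| ≤ Λ ∧ C * w x = Λ * |w x| := by
    rcases le_total 0 (w x) with h0 | h0
    · exact ⟨Λ, (abs_of_nonneg hΛ).le, by rw [abs_of_nonneg h0]⟩
    · exact ⟨-Λ, by rw [abs_neg, abs_of_nonneg hΛ], by rw [abs_of_nonpos h0]; ring⟩
  -- the measure
  obtain ⟨μ, hμ0, hμ1, hμ2⟩ : ∃ μ : Measure (Euc d), μ {x} = 0 ∧
      (∫⁻ y, ENNReal.ofReal (m y) ∂μ) ≤ ENNReal.ofReal Λ ∧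
      Λ * ((⨆ y, q y) / 2) ≤ ∫ y, lint w x y ∂μ := by
    rcases hS0.eq_or_lt with h0 | h0
    · exact ⟨0, by simp, by simp, by simp [← h0]⟩
    obtain ⟨y, hy⟩ := exists_lt_of_lt_ciSup (half_lt_self h0)
    have hyx : y ≠ x := by
      rintro rfl
      have : q y = 0 := by simp [hq, hmx]
      linarith
    have hmy := hm0 y hyx
    refine ⟨ENNReal.ofReal (Λ / m y) • Measure.dirac y, ?_, ?_, ?_⟩
    · simp [hyx]
    · rw [lintegral_smul_measure, lintegral_dirac, smul_eq_mul,
        ← ENNReal.ofReal_mul (by positivity), div_mul_cancel₀ _ hmy.ne']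
    · rw [integral_smul_measure, integral_dirac, ENNReal.toReal_ofReal (by positivity),
        smul_eq_mul]
      have : Λ / m y * lint w x y = Λ * q y := by simp only [hq]; ring
      rw [this]
      exact mul_le_mul_of_nonneg_left hy.le hΛ
  refine ⟨⟨x, 0, B, C, μ⟩, ⟨?_, ?_, ?_, hB1, hC1, hμ0, hμ1⟩, rfl, rfl, ?_⟩
  · exact Matrix.isSymm_zero
  · exact Matrix.PosSemidef.zero
  · intro i j; simpa using hΛ
  · unfold LevyData.apply
    unfold lint at hμ2
    simp only [Matrix.zero_apply, zero_mul, Finset.sum_const_zero, zero_add, hB2, hC2]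
    linarith

/-- min-max formula for Lipschitz operators `I : C²_b(ℝ^d) → C_b(ℝ^d)`
satisfying the global comparison property and the locality assumption. -/
theorem minmax_C2b (d : ℕ) (hd : 1 ≤ d) (K₀ : ℝ) (hK₀ : 0 ≤ K₀) :
    ∃ Λ : ℝ, 0 < Λ ∧
      ∀ I : (Euc d → ℝ) → Euc d → ℝ,
        (∀ u, IsC2b u → IsCb (I u)) →
        LipWith K₀ IsC2b C2Norm I →
        GCP IsC2b I →
        Locality IsC2b localC2Norm I →
        ∃ 𝒦 : Set (LevyData d),
          (∀ L ∈ 𝒦, LevyBounds Λ L) ∧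
          (∀ u v, IsC2b u → IsC2b v → ∀ x : Euc d,
            ∃ L ∈ 𝒦, L.base = x ∧ I u x ≤ I v x + L.apply (fun y => u y - v y)) ∧
          (∀ u, IsC2b u → ∀ x : Euc d,
            I u x = sInf {r : ℝ | ∃ v, IsC2b v ∧
                r = sSup {s : ℝ | ∃ L ∈ 𝒦, L.base = x ∧
                      s = I v x + L.apply (fun y => u y - v y)}} ∧
            sSup {s : ℝ | ∃ L ∈ 𝒦, L.base = x ∧
                s = I u x + L.apply (fun y => u y - u y)} = I u x) := by
  obtain ⟨M, hM1, χ, ψ, hχ1, hχ0, hχle, hχ2, hψ0, hψ, hψB, hlin⟩ := exists_barriers d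
  have hKM : 0 ≤ K₀ * M := mul_nonneg hK₀ (by linarith)
  have hΛ : (0 : ℝ) < 6 * (K₀ * M) * (d + 2) + 1 := by positivity
  set Λ : ℝ := 6 * (K₀ * M) * (d + 2) + 1 with hΛdef
  refine ⟨Λ, hΛ, ?_⟩
  intro I _ hLip hGCP _
  set 𝒦 : Set (LevyData d) := {L | LevyBounds Λ L ∧ L.A = 0} with h𝒦
  have key : ∀ u v, IsC2b u → IsC2b v → ∀ x : Euc d,
      ∃ L ∈ 𝒦, L.base = x ∧ I u x ≤ I v x + L.apply (fun y => u y - v y) := by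
    intro u v hu hv x
    obtain ⟨N, hN⟩ := hu.sub hv
    set w : Euc d → ℝ := fun y => u y - v y with hw
    obtain ⟨S, hS0, hS, L, hL, hLA, hLx, hLw⟩ := exists_extremal hΛ.le hN x
    refine ⟨L, ⟨hL, hLA⟩, hLx, ?_⟩
    set p := fderiv ℝ w x with hp
    set P : ℝ := ‖p‖ with hP
    have hP0 : 0 ≤ P := norm_nonneg _
    -- the barrier
    set φ : Euc d → ℝ := fun y => (w x + ∑ i, p (EuclideanSpace.single i 1) *
      ((y - x) i * χ (y - x))) + (S + 2 * P) * ψ (y - x) with hφ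
    have hlinp : ∀ z : Euc d, ∑ i, p (EuclideanSpace.single i 1) * (z i * χ z) = p z * χ z := by
      intro z
      have hz : p z = ∑ i, z i * p (EuclideanSpace.single i 1) := by
        conv_lhs => rw [← (EuclideanSpace.basisFun (Fin d) ℝ).sum_repr z]
        simp
      rw [hz, Finset.sum_mul]
      exact Finset.sum_congr rfl fun i _ => by ring
    have hφB : Bd (M * (|w x| + (d + 2) * P + S)) φ := by
      have h1 := (Bd.const (d := d) (w x)).add (Bd.sum Finset.univ fun i =>
        ((hlin i).translate x).smul (p (EuclideanSpace.single i 1)))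
      have h2 := h1.add ((hψB.translate x).smul (S + 2 * P))
      refine h2.mono ?_
      have h3 : ∑ i : Fin d, |p (EuclideanSpace.single i 1)| * M ≤ ∑ _i : Fin d, P * M := by
        refine Finset.sum_le_sum fun i _ => mul_le_mul_of_nonneg_right ?_ (by linarith)
        simpa using p.le_opNorm (EuclideanSpace.single i 1)
      rw [Finset.sum_const, Finset.card_univ, Fintype.card_fin, nsmul_eq_mul] at h3
      rw [abs_of_nonneg (by positivity : 0 ≤ S + 2 * P)]
      nlinarith [abs_nonneg (w x)]
    have hφx : φ x = w x := by simp [hφ, hψ0]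
    have hwφ : ∀ y, w y ≤ φ y := by
      intro y
      have a := hS y
      have b := hψ (y - x)
      have hmin : 0 ≤ min 1 (‖y - x‖ ^ 2) := by positivity
      have c : S * min 1 (‖y - x‖ ^ 2) ≤ S * ψ (y - x) := mul_le_mul_of_nonneg_left b hS0
      simp only [hφ]
      rw [hlinp]
      unfold lint at a
      by_cases hy : y ∈ ball x 1
      · rw [indicator_of_mem hy] at a
        have hy1 : ‖y - x‖ < 1 := by simpa [dist_eq_norm] using hy
        rw [hχ1 _ hy1.le]
        have : 0 ≤ P * ψ (y - x) := mul_nonneg hP0 (hmin.trans b)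
        linarith
      · rw [indicator_of_notMem hy] at a
        have hy1 : 1 ≤ ‖y - x‖ := by simpa [dist_eq_norm] using hy
        have hb1 : 1 ≤ ψ (y - x) := by
          rwa [min_eq_left (by nlinarith)] at b
        have e : -(2 * P) ≤ p (y - x) * χ (y - x) := by
          by_cases h2 : 2 ≤ ‖y - x‖
          · rw [hχ2 _ h2]; linarith
          · have e1 : |p (y - x)| ≤ P * ‖y - x‖ := p.le_opNorm _
            have e2 : P * ‖y - x‖ ≤ P * 2 := mul_le_mul_of_nonneg_left (not_le.1 h2).le hP0
            have e3 : |p (y - x) * χ (y - x)| ≤ 2 * P := by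
              rw [abs_mul, abs_of_nonneg (hχ0 _)]
              nlinarith [hχ0 (y - x), hχle (y - x), abs_nonneg (p (y - x))]
            exact (abs_le.1 e3).1
        have : P * 1 ≤ P * ψ (y - x) := mul_le_mul_of_nonneg_left hb1 hP0
        linarith
    have hv' : IsC2b (fun y => v y + φ y) := by
      obtain ⟨hv1, N', hN'⟩ := hv
      exact (Bd.add (M := N') ⟨hv1, hN'⟩ hφB).isC2b
    have g1 : I u x ≤ I (fun y => v y + φ y) x := by
      refine hGCP _ _ hu hv' (fun y => ?_) x ?_
      · have := hwφ y
        simp only [hw] at this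
        linarith
      · simp only [hφx, hw]
        ring
    have g2 := (le_abs_self _).trans (hLip _ _ hv' hv x)
    simp only [add_sub_cancel_left] at g2
    have g3 : K₀ * C2Norm φ ≤ K₀ * (3 * (M * (|w x| + (d + 2) * P + S))) :=
      mul_le_mul_of_nonneg_left hφB.c2Norm_le hK₀
    have g4 : K₀ * (3 * (M * (|w x| + (d + 2) * P + S))) ≤ Λ * (P + |w x| + S / 2) := by
      have t : 0 ≤ |w x| := abs_nonneg _
      have hd0 : (0 : ℝ) ≤ d := Nat.cast_nonneg d
      have i1 : 0 ≤ K₀ * M * |w x| := mul_nonneg hKM t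
      have i2 : 0 ≤ K₀ * M * P := mul_nonneg hKM hP0
      have i3 : 0 ≤ K₀ * M * S := mul_nonneg hKM hS0
      have j1 : 0 ≤ K₀ * M * |w x| * d := mul_nonneg i1 hd0
      have j2 : 0 ≤ K₀ * M * P * d := mul_nonneg i2 hd0
      have j3 : 0 ≤ K₀ * M * S * d := mul_nonneg i3 hd0
      rw [hΛdef]
      nlinarith
    linarith
  have h0 : ∀ L : LevyData d, L.apply (fun _ => (0 : ℝ)) = 0 := by
    intro L
    simp [LevyData.apply, iteratedFDeriv_const_of_ne (𝕜 := ℝ) (two_ne_zero)]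
  have hself : ∀ u, IsC2b u → ∀ x : Euc d,
      sSup {s : ℝ | ∃ L ∈ 𝒦, L.base = x ∧ s = I u x + L.apply (fun y => u y - u y)} = I u x := by
    intro u hu x
    have : {s : ℝ | ∃ L ∈ 𝒦, L.base = x ∧ s = I u x + L.apply (fun y => u y - u y)} = {I u x} := by
      ext s
      simp only [sub_self, h0, add_zero, mem_ofPred_eq, mem_singleton_iff]
      constructor
      · rintro ⟨L, _, _, h⟩
        exact h
      · intro h
        obtain ⟨L, hL, hx, _⟩ := key u u hu hu x
        exact ⟨L, hL, hx, h⟩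
    rw [this, csSup_singleton]
  refine ⟨𝒦, fun L hL => hL.1, key, fun u hu x => ⟨?_, hself u hu x⟩⟩
  have hleast : IsLeast {r : ℝ | ∃ v, IsC2b v ∧
      r = sSup {s : ℝ | ∃ L ∈ 𝒦, L.base = x ∧
        s = I v x + L.apply (fun y => u y - v y)}} (I u x) := by
    refine ⟨⟨u, hu, (hself u hu x).symm⟩, ?_⟩
    rintro _ ⟨v, hv, rfl⟩
    obtain ⟨L, hL, hx, hle⟩ := key u v hu hv x
    refine hle.trans (le_csSup ?_ ⟨L, hL, hx, rfl⟩)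
    obtain ⟨N, hN⟩ := hu.sub hv
    refine ⟨I v x + 4 * (N * Λ), ?_⟩
    rintro _ ⟨L', hL', _, rfl⟩
    have := apply_bound hN L' hL'.1 hL'.2 hΛ.le
    linarith
  exact hleast.csInf_eq.symm

end
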